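/- For every ε > 0 there exists a constant c_ε > 0 such that the following holds. Let n ≥ 1 be an integer, let q ∈ (0, 1−ε), let π have the Mallows distribution μ_{n,q}, and let 0 ≤ s ≤ n. Define T_s := min{t : s ≤ t ≤ n, κ_t(π) = 0} (which is well defined since κ_n(π) = 0). Then E[(T_s − s)²] ≤ c_ε · q. -/

import Mathlib

open Finset
open scoped Classical BigOperators

noncomputable section

/-- Number of inversions of a permutation of `Fin n` (0-indexed positions). -/
def invCount (n : ℕ) (π : Equiv.Perm (Fin n)) : ℕ :=
  ((Finset.univ : Finset (Fin n × Fin n)).filter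
    (fun p => p.1 < p.2 ∧ π p.2 < π p.1)).card

/-- Normalizing constant of the Mallows distribution. -/
def mallowsZ (n : ℕ) (q : ℝ) : ℝ :=
  ∑ σ : Equiv.Perm (Fin n), q ^ invCount n σ

/-- Mallows probability of an individual permutation. -/
def mallowsP (n : ℕ) (q : ℝ) (π : Equiv.Perm (Fin n)) : ℝ :=
  q ^ invCount n π / mallowsZ n q

/-- Expectation of a real-valued functional under the Mallows distribution. -/
def mExp (n : ℕ) (q : ℝ) (X : Equiv.Perm (Fin n) → ℝ) : ℝ :=
  ∑ π : Equiv.Perm (Fin n), mallowsP n q π * X π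

/-- Probability of an event under the Mallows distribution. -/
def mProb (n : ℕ) (q : ℝ) (A : Equiv.Perm (Fin n) → Prop) : ℝ :=
  ∑ π : Equiv.Perm (Fin n), if A π then mallowsP n q π else 0

/-- Conditional probability of `A` given `B` under the Mallows distribution. -/
def mCondProb (n : ℕ) (q : ℝ) (A B : Equiv.Perm (Fin n) → Prop) : ℝ :=
  mProb n q (fun π => A π ∧ B π) / mProb n q B

/-- The arc chain `κ_t(π) = |{i ∈ {1,…,t} : π(i) > t}|` (here expressed with
0-indexed positions and values of a permutation of `Fin n`). -/
def kappa (n t : ℕ) (π : Equiv.Perm (Fin n)) : ℕ :=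
  (Finset.univ.filter (fun i : Fin n => (i : ℕ) < t ∧ t ≤ ((π i : ℕ)))).card

/-- The hitting time of zero of the arc chain after time `s`:
`T_s = min{t : s ≤ t ≤ n, κ_t(π) = 0}`. -/
def hitZero (n s : ℕ) (π : Equiv.Perm (Fin n)) : ℕ :=
  sInf {t : ℕ | s ≤ t ∧ t ≤ n ∧ kappa n t π = 0}


/-! ### Insertion of a first value -/

/-- The permutation with first value `a` and remaining pattern `σ`. -/
def consPerm {n : ℕ} (a : Fin (n + 1)) (σ : Equiv.Perm (Fin n)) : Equiv.Perm (Fin (n + 1)) :=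
  Equiv.ofBijective (Fin.cons a (fun i => a.succAbove (σ i)) : Fin (n + 1) → Fin (n + 1)) (by
    apply Finite.injective_iff_bijective.mp
    rw [Fin.cons_injective_iff]
    refine ⟨?_, fun i j h => σ.injective (Fin.succAbove_right_injective h)⟩
    rintro ⟨i, hi⟩
    exact Fin.succAbove_ne a _ hi)

lemma consPerm_zero {n : ℕ} (a : Fin (n + 1)) (σ : Equiv.Perm (Fin n)) :
    consPerm a σ 0 = a := by simp [consPerm]

lemma consPerm_succ {n : ℕ} (a : Fin (n + 1)) (σ : Equiv.Perm (Fin n)) (i : Fin n) :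
    consPerm a σ i.succ = a.succAbove (σ i) := by simp [consPerm]

lemma consPerm_bij (n : ℕ) :
    Function.Bijective (fun p : Fin (n + 1) × Equiv.Perm (Fin n) => consPerm p.1 p.2) := by
  rw [Fintype.bijective_iff_injective_and_card]
  constructor
  · rintro ⟨a, σ⟩ ⟨b, τ⟩ h
    simp only at h
    have h0 : a = b := by
      have := congrArg (fun e : Equiv.Perm (Fin (n + 1)) => e 0) h
      simpa [consPerm_zero] using this
    subst h0
    congr 1
    ext1 i
    have := congrArg (fun e : Equiv.Perm (Fin (n + 1)) => e i.succ) h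
    simp only [consPerm_succ] at this
    exact Fin.succAbove_right_injective this
  · simp [Fintype.card_perm, Nat.factorial_succ]

lemma sum_consPerm (n : ℕ) (F : Equiv.Perm (Fin (n + 1)) → ℝ) :
    ∑ π, F π = ∑ a : Fin (n + 1), ∑ σ : Equiv.Perm (Fin n), F (consPerm a σ) := by
  rw [← (consPerm_bij n).sum_comp F, Fintype.sum_prod_type]

lemma invCount_eq (n : ℕ) (π : Equiv.Perm (Fin n)) :
    invCount n π = ∑ i : Fin n, ∑ j : Fin n, if i < j ∧ π j < π i then 1 else 0 := by
  rw [invCount, Finset.card_filter, Fintype.sum_prod_type]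

lemma invCount_cons {n : ℕ} (a : Fin (n + 1)) (σ : Equiv.Perm (Fin n)) :
    invCount (n + 1) (consPerm a σ) = (a : ℕ) + invCount n σ := by
  rw [invCount_eq, invCount_eq, Fin.sum_univ_succ]
  congr 1
  · rw [Fin.sum_univ_succ]
    simp only [consPerm_zero, consPerm_succ, lt_irrefl, false_and, if_false, Fin.succ_pos,
      true_and, zero_add, Fin.succAbove_lt_iff_castSucc_lt]
    rw [Equiv.sum_comp σ (fun j => if j.castSucc < a then 1 else 0), ← Finset.card_filter]
    have : (Finset.univ.filter (fun j : Fin n => j.castSucc < a)).card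
        = (Finset.range (a : ℕ)).card := by
      apply Finset.card_bij (fun (j : Fin n) _ => (j : ℕ))
      · intro j hj
        simpa [Fin.lt_def] using hj
      · intro i _ j _ h
        exact Fin.ext h
      · intro b hb
        have hb' : b < (a : ℕ) := by simpa using hb
        have := a.isLt
        exact ⟨⟨b, by omega⟩, by simpa [Fin.lt_def] using hb', rfl⟩
    simpa using this
  · apply Finset.sum_congr rfl
    intro i _
    rw [Fin.sum_univ_succ]
    simp [consPerm_succ, Fin.succ_lt_succ_iff, Fin.succAbove_lt_succAbove_iff]

/-! ### Generalized hitting time -/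

/-- `t` is a zero of the chain started at level `m`. -/
def arcZ (n m : ℕ) (π : Equiv.Perm (Fin n)) (t : ℕ) : Prop :=
  m ≤ t ∧ ∀ i : Fin n, (i : ℕ) < t → (π i : ℕ) < t

/-- First zero at or after `s`, with initial level `m`. -/
def hitG (n m s : ℕ) (π : Equiv.Perm (Fin n)) : ℕ :=
  sInf {t : ℕ | s ≤ t ∧ arcZ n m π t}

lemma hitG_nonempty (n m s : ℕ) (π : Equiv.Perm (Fin n)) :
    {t : ℕ | s ≤ t ∧ arcZ n m π t}.Nonempty := by
  refine ⟨n + m + s, by omega, by omega, fun i _ => ?_⟩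
  have := (π i).isLt
  omega

lemma kappa_eq_zero (n t : ℕ) (π : Equiv.Perm (Fin n)) :
    kappa n t π = 0 ↔ arcZ n 0 π t := by
  simp [kappa, arcZ, Finset.filter_eq_empty_iff]

lemma hitZero_eq (n s : ℕ) (hs : s ≤ n) (π : Equiv.Perm (Fin n)) :
    hitZero n s π = hitG n 0 s π := by
  unfold hitZero
  have hn : n ∈ {t : ℕ | s ≤ t ∧ arcZ n 0 π t} := ⟨hs, Nat.zero_le _, fun i _ => (π i).isLt⟩
  have hle : hitG n 0 s π ≤ n := Nat.sInf_le hn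
  have hmem := Nat.sInf_mem (hitG_nonempty n 0 s π)
  apply le_antisymm
  · apply Nat.sInf_le
    exact ⟨hmem.1, hle, (kappa_eq_zero _ _ _).2 hmem.2⟩
  · have h2 := Nat.sInf_mem (s := {t : ℕ | s ≤ t ∧ t ≤ n ∧ kappa n t π = 0})
      ⟨n, hs, le_rfl, (kappa_eq_zero _ _ _).2 hn.2⟩
    exact Nat.sInf_le ⟨h2.1, (kappa_eq_zero _ _ _).1 h2.2.2⟩

lemma arcZ_cons {n : ℕ} (m t : ℕ) (a : Fin (n + 1)) (σ : Equiv.Perm (Fin n)) :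
    arcZ (n + 1) m (consPerm a σ) (t + 1) ↔ arcZ n (max (m - 1) a) σ t := by
  unfold arcZ
  rw [Fin.forall_fin_succ]
  simp only [consPerm_zero, consPerm_succ, Fin.val_zero, Fin.val_succ]
  have key : (a : ℕ) ≤ t → ∀ i : Fin n, ((a.succAbove (σ i) : Fin (n + 1)) : ℕ) < t + 1 ↔
      (σ i : ℕ) < t := by
    intro ha i
    by_cases h : (σ i).castSucc < a
    · rw [Fin.succAbove_of_castSucc_lt _ _ h]
      rw [Fin.lt_def] at h
      simp only [Fin.val_castSucc] at h ⊢
      omega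
    · rw [Fin.succAbove_of_le_castSucc _ _ (not_lt.mp h)]
      simp
  constructor
  · rintro ⟨h1, h2, h3⟩
    have ha : (a : ℕ) ≤ t := by have := h2 (by omega); omega
    exact ⟨by omega, fun i hi => (key ha i).1 (h3 i (by omega))⟩
  · rintro ⟨h1, h3⟩
    have ha : (a : ℕ) ≤ t := by omega
    exact ⟨by omega, fun _ => by omega, fun i hi => (key ha i).2 (h3 i (by omega))⟩

lemma hitG_cons {n : ℕ} (m s s' : ℕ) (a : Fin (n + 1)) (σ : Equiv.Perm (Fin n))
    (h : s = s' + 1 ∨ (s = 0 ∧ s' = 0 ∧ 1 ≤ m)) :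
    hitG (n + 1) m s (consPerm a σ) = hitG n (max (m - 1) a) s' σ + 1 := by
  have h1 := Nat.sInf_mem (hitG_nonempty (n + 1) m s (consPerm a σ))
  have h2 := Nat.sInf_mem (hitG_nonempty n (max (m - 1) a) s' σ)
  change s ≤ hitG (n + 1) m s (consPerm a σ) ∧ arcZ _ _ _ (hitG (n + 1) m s (consPerm a σ)) at h1
  change s' ≤ hitG n (max (m - 1) a) s' σ ∧ arcZ _ _ _ (hitG n (max (m - 1) a) s' σ) at h2
  apply le_antisymm
  · apply Nat.sInf_le
    exact ⟨by omega, (arcZ_cons _ _ _ _).2 h2.2⟩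
  · have hpos : 1 ≤ hitG (n + 1) m s (consPerm a σ) := by
      have := h1.2.1
      omega
    obtain ⟨t, ht⟩ := Nat.exists_eq_add_of_le' hpos
    rw [ht] at h1 ⊢
    have : hitG n (max (m - 1) a) s' σ ≤ t :=
      Nat.sInf_le ⟨by omega, (arcZ_cons _ _ _ _).1 h1.2⟩
    omega

lemma hitG_zero_zero (n : ℕ) (π : Equiv.Perm (Fin n)) : hitG n 0 0 π = 0 := by
  apply Nat.le_zero.mp
  apply Nat.sInf_le
  exact ⟨le_rfl, le_rfl, fun i hi => by omega⟩

lemma hitG_n0 (m s : ℕ) (π : Equiv.Perm (Fin 0)) : hitG 0 m s π = max m s := by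
  have h1 := Nat.sInf_mem (hitG_nonempty 0 m s π)
  apply le_antisymm
  · apply Nat.sInf_le
    exact ⟨by omega, by omega, fun i => i.elim0⟩
  · exact max_le h1.2.1 h1.1

/-! ### Unnormalized sums -/

/-- Unnormalized Mallows sum. -/
def mSum (n : ℕ) (q : ℝ) (F : Equiv.Perm (Fin n) → ℝ) : ℝ :=
  ∑ π : Equiv.Perm (Fin n), q ^ invCount n π * F π

lemma mSum_succ (n : ℕ) (q : ℝ) (F : Equiv.Perm (Fin (n + 1)) → ℝ) :
    mSum (n + 1) q F
      = ∑ a : Fin (n + 1), q ^ (a : ℕ) * mSum n q (fun σ => F (consPerm a σ)) := by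
  unfold mSum
  rw [sum_consPerm]
  apply Finset.sum_congr rfl
  intro a _
  rw [Finset.mul_sum]
  apply Finset.sum_congr rfl
  intro σ _
  rw [invCount_cons, pow_add]
  ring

lemma mallowsZ_succ (n : ℕ) (q : ℝ) :
    mallowsZ (n + 1) q = (∑ a ∈ range (n + 1), q ^ a) * mallowsZ n q := by
  have h : ∀ k, mallowsZ k q = mSum k q (fun _ => 1) := by
    intro k; simp [mSum, mallowsZ]
  rw [h, h, mSum_succ, Finset.sum_mul, Finset.sum_range]

lemma mallowsZ_zero (q : ℝ) : mallowsZ 0 q = 1 := by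
  simp [mallowsZ, invCount]

lemma mallowsZ_pos (n : ℕ) (q : ℝ) (hq : 0 < q) : 0 < mallowsZ n q := by
  unfold mallowsZ
  exact Finset.sum_pos (fun _ _ => pow_pos hq _) Finset.univ_nonempty

lemma mSum_zero (q : ℝ) (F : Equiv.Perm (Fin 0) → ℝ) (c : ℝ) (h : ∀ π, F π = c) :
    mSum 0 q F = c := by
  simp [mSum, invCount, h]

/-! ### Truncated geometric sums -/

lemma geo_tail (q : ℝ) (hq : 0 < q) (i n : ℕ) :
    ∑ a ∈ range (n + 1), (if i < a then q ^ a else 0)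
      ≤ q ^ (i + 1) * ∑ a ∈ range (n + 1), q ^ a := by
  rw [← Finset.sum_filter]
  have h0 : ∑ a ∈ range (n + 1), q ^ (i + 1 + a) = q ^ (i + 1) * ∑ a ∈ range (n + 1), q ^ a := by
    rw [Finset.mul_sum]
    exact Finset.sum_congr rfl fun a _ => pow_add _ _ _
  rw [← h0]
  have h1 : ∑ a ∈ (range (n + 1)).image (fun a => i + 1 + a), q ^ a
      = ∑ a ∈ range (n + 1), q ^ (i + 1 + a) := by
    rw [Finset.sum_image]
    intro x _ y _ hxy
    simpa using hxy
  rw [← h1]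
  apply Finset.sum_le_sum_of_subset_of_nonneg
  · intro a ha
    simp only [mem_filter, mem_range, mem_image] at ha ⊢
    exact ⟨a - (i + 1), by omega, by omega⟩
  · intro a _ _
    positivity

lemma geo_max (q : ℝ) (hq : 0 < q) (D : ℕ → ℝ) (hD : ∀ i, 0 ≤ D i) (m n : ℕ) :
    ∑ a ∈ range (n + 1), q ^ a * (∑ i ∈ range (max m a), D i)
      ≤ (∑ a ∈ range (n + 1), q ^ a) *
        ((∑ i ∈ range m, D i) + ∑ i ∈ Ico m n, D i * q ^ (i + 1)) := by
  have h1 : ∀ a ∈ range (n + 1), q ^ a * (∑ i ∈ range (max m a), D i)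
      = q ^ a * (∑ i ∈ range m, D i)
        + ∑ i ∈ Ico m n, D i * (if i < a then q ^ a else 0) := by
    intro a ha
    have ha' : a ≤ n := by simp at ha; omega
    rw [← Finset.sum_range_add_sum_Ico _ (le_max_left m a), mul_add]
    congr 1
    have : ∀ i ∈ Ico m n, D i * (if i < a then q ^ a else 0) = if i < a then q ^ a * D i else 0 := by
      intro i _
      split_ifs <;> ring
    rw [Finset.sum_congr rfl this, ← Finset.sum_filter, Finset.mul_sum]
    apply Finset.sum_congr _ fun _ _ => rfl
    ext i
    simp only [mem_Ico, mem_filter]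
    omega
  rw [Finset.sum_congr rfl h1, Finset.sum_add_distrib, ← Finset.sum_mul, mul_add,
    Finset.sum_comm]
  gcongr
  rw [Finset.mul_sum]
  apply Finset.sum_le_sum
  intro i _
  rw [← Finset.mul_sum]
  calc _ ≤ D i * (q ^ (i + 1) * ∑ a ∈ range (n + 1), q ^ a) :=
        mul_le_mul_of_nonneg_left (geo_tail q hq i n) (hD i)
    _ = _ := by ring

/-! ### Lyapunov functions -/

/-- First-moment bound. -/
def lyA (P : ℕ → ℝ) (m : ℕ) : ℝ := ∑ i ∈ range m, P (i + 1)

/-- Increments of the second-moment bound. -/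
def lyD (P : ℕ → ℝ) (S : ℝ) (i : ℕ) : ℝ := (2 * (i + 1) + 2 * S) * P (i + 1)

/-- Second-moment bound. -/
def lyB (P : ℕ → ℝ) (S : ℝ) (m : ℕ) : ℝ := ∑ i ∈ range m, lyD P S i

/-- Hypotheses on the auxiliary sequence. -/
structure GoodSeq (P : ℕ → ℝ) (S q : ℝ) : Prop where
  hq : 0 < q
  one_le : ∀ i, 1 ≤ P i
  dec : ∀ i, P (i + 1) * q ^ (i + 1) ≤ P (i + 1) - P (i + 2)
  hS : ∀ N, ∑ i ∈ range N, (P (i + 1) - 1) ≤ S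

namespace GoodSeq

variable {P : ℕ → ℝ} {S q : ℝ}

lemma S_nonneg (h : GoodSeq P S q) : 0 ≤ S := by simpa using h.hS 0

lemma lyD_nonneg (h : GoodSeq P S q) (i : ℕ) : 0 ≤ lyD P S i := by
  have := h.S_nonneg
  have := h.one_le (i + 1)
  unfold lyD
  positivity

lemma lyA_le (h : GoodSeq P S q) (n : ℕ) : 2 * lyA P (n + 1) ≤ lyD P S n := by
  have h1 := h.hS (n + 1)
  have h2 := h.one_le (n + 1)
  have h3 := h.S_nonneg
  simp only [Finset.sum_sub_distrib, Finset.sum_const, card_range, nsmul_eq_mul, mul_one] at h1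
  push_cast at h1
  unfold lyA lyD
  have h4 : (0 : ℝ) ≤ 2 * (n + 1) + 2 * S := by positivity
  nlinarith

lemma tailA (h : GoodSeq P S q) (m n : ℕ) :
    ∑ i ∈ Ico m n, P (i + 1) * q ^ (i + 1) ≤ P (m + 1) - 1 := by
  rcases le_total n m with hnm | hmn
  · rw [Finset.Ico_eq_empty_of_le hnm]
    have := h.one_le (m + 1)
    simpa using this
  · have : ∑ i ∈ Ico m n, P (i + 1) * q ^ (i + 1) ≤ P (m + 1) - P (n + 1) := by
      induction n, hmn using Nat.le_induction with
      | base => simp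
      | succ n hmn ih =>
        rw [Finset.sum_Ico_succ_top hmn]
        have := h.dec n
        linarith
    have := h.one_le (n + 1)
    linarith

lemma tailB (h : GoodSeq P S q) (m n : ℕ) :
    ∑ i ∈ Ico m n, lyD P S i * q ^ (i + 1) ≤ lyD P S m - 2 * lyA P (m + 1) := by
  rcases le_total n m with hnm | hmn
  · rw [Finset.Ico_eq_empty_of_le hnm]
    have := h.lyA_le m
    simpa using this
  · have : ∑ i ∈ Ico m n, lyD P S i * q ^ (i + 1)
        ≤ lyD P S m - lyD P S n + 2 * lyA P (n + 1) - 2 * lyA P (m + 1) := by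
      induction n, hmn using Nat.le_induction with
      | base => simp
      | succ n hmn ih =>
        rw [Finset.sum_Ico_succ_top hmn]
        have h1 := h.dec n
        have h2 : lyA P (n + 1 + 1) = lyA P (n + 1) + P (n + 2) := by
          unfold lyA
          rw [Finset.sum_range_succ]
        have h3 := h.S_nonneg
        have h4 : (0 : ℝ) ≤ 2 * (n + 1) + 2 * S := by positivity
        have h5 := mul_le_mul_of_nonneg_left h1 h4
        rw [h2]
        unfold lyD at ih ⊢
        push_cast at ih ⊢
        linarith
    have := h.lyA_le n
    linarith

lemma stepA (h : GoodSeq P S q) (m n : ℕ) :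
    ∑ a ∈ range (n + 1), q ^ a * lyA P (max m a)
      ≤ (∑ a ∈ range (n + 1), q ^ a) * (lyA P (m + 1) - 1) := by
  refine (geo_max q h.hq (fun i => P (i + 1))
    (fun i => by linarith [h.one_le (i + 1)]) m n).trans ?_
  have hq := h.hq
  apply mul_le_mul_of_nonneg_left _ (by positivity)
  have := h.tailA m n
  unfold lyA
  rw [Finset.sum_range_succ]
  linarith

lemma stepB (h : GoodSeq P S q) (m n : ℕ) :
    ∑ a ∈ range (n + 1), q ^ a * lyB P S (max m a)
      ≤ (∑ a ∈ range (n + 1), q ^ a) * (lyB P S (m + 1) - 2 * lyA P (m + 1)) := by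
  refine (geo_max q h.hq (lyD P S) h.lyD_nonneg m n).trans ?_
  have hq := h.hq
  apply mul_le_mul_of_nonneg_left _ (by positivity)
  have := h.tailB m n
  unfold lyB
  rw [Finset.sum_range_succ]
  linarith

lemma lyA_ge (h : GoodSeq P S q) (m : ℕ) : (m : ℝ) ≤ lyA P m := by
  induction m with
  | zero => simp [lyA]
  | succ m ih =>
    have := h.one_le (m + 1)
    unfold lyA at ih ⊢
    rw [Finset.sum_range_succ]
    push_cast
    linarith

lemma lyB_ge (h : GoodSeq P S q) (m : ℕ) : (m : ℝ) ^ 2 ≤ lyB P S m := by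
  induction m with
  | zero => simp [lyB]
  | succ m ih =>
    have h1 := h.lyA_le m
    have h2 := h.lyA_ge (m + 1)
    unfold lyB at ih ⊢
    rw [Finset.sum_range_succ]
    push_cast at h2 ⊢
    linarith

lemma lyB_nonneg (h : GoodSeq P S q) (m : ℕ) : 0 ≤ lyB P S m :=
  (sq_nonneg _).trans (h.lyB_ge m)

lemma claimA (h : GoodSeq P S q) (n : ℕ) : ∀ m k : ℕ,
    mSum n q (fun π => ((k : ℝ) + hitG n m 0 π) ^ 2)
      ≤ mallowsZ n q * ((k : ℝ) ^ 2 + 2 * k * lyA P m + lyB P S m) := by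
  induction n with
  | zero =>
    intro m k
    rw [mSum_zero q _ (((k : ℝ) + m) ^ 2) (fun π => by rw [hitG_n0]; simp), mallowsZ_zero]
    have h1 := h.lyA_ge m
    have h2 := h.lyB_ge m
    have h3 : (0 : ℝ) ≤ k := by positivity
    nlinarith
  | succ n ih =>
    intro m k
    rcases Nat.eq_zero_or_pos m with rfl | hm
    · simp only [hitG_zero_zero]
      apply le_of_eq
      simp [mSum, mallowsZ, lyA, lyB, Finset.sum_mul]
    · obtain ⟨m, rfl⟩ : ∃ m' : ℕ, m = m' + 1 := ⟨m - 1, by omega⟩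
      rw [mSum_succ]
      have hq := h.hq
      have hZ := mallowsZ_pos n q hq
      have e1 : ∀ a : Fin (n + 1), q ^ (a : ℕ) *
          mSum n q (fun σ => ((k : ℝ) + hitG (n + 1) (m + 1) 0 (consPerm a σ)) ^ 2)
          ≤ q ^ (a : ℕ) * (mallowsZ n q * (((k + 1 : ℕ) : ℝ) ^ 2
            + 2 * ((k + 1 : ℕ) : ℝ) * lyA P (max m a) + lyB P S (max m a))) := by
        intro a
        apply mul_le_mul_of_nonneg_left _ (by positivity)
        refine le_trans (le_of_eq ?_) (ih (max m a) (k + 1))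
        congr 1
        funext σ
        rw [hitG_cons (m + 1) 0 0 a σ (by omega)]
        rw [Nat.add_sub_cancel]
        push_cast
        ring
      refine (Finset.sum_le_sum fun a _ => e1 a).trans ?_
      rw [← Finset.sum_range (fun a : ℕ => q ^ a * (mallowsZ n q * (((k + 1 : ℕ) : ℝ) ^ 2
            + 2 * ((k + 1 : ℕ) : ℝ) * lyA P (max m a) + lyB P S (max m a))))]
      have e2 : ∑ a ∈ range (n + 1), q ^ a * (mallowsZ n q * (((k + 1 : ℕ) : ℝ) ^ 2
            + 2 * ((k + 1 : ℕ) : ℝ) * lyA P (max m a) + lyB P S (max m a)))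
          = mallowsZ n q * (((k + 1 : ℕ) : ℝ) ^ 2 * (∑ a ∈ range (n + 1), q ^ a)
            + 2 * ((k + 1 : ℕ) : ℝ) * (∑ a ∈ range (n + 1), q ^ a * lyA P (max m a))
            + ∑ a ∈ range (n + 1), q ^ a * lyB P S (max m a)) := by
        rw [Finset.mul_sum, Finset.mul_sum, ← Finset.sum_add_distrib, ← Finset.sum_add_distrib,
          Finset.mul_sum]
        apply Finset.sum_congr rfl
        intro a _
        ring
      rw [e2, mallowsZ_succ]
      have hA := h.stepA m n
      have hB := h.stepB m n
      have hW : 0 < ∑ a ∈ range (n + 1), q ^ a :=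
        Finset.sum_pos (fun _ _ => pow_pos hq _) ⟨0, by simp⟩
      set W := ∑ a ∈ range (n + 1), q ^ a
      have hk : (0 : ℝ) ≤ 2 * ((k + 1 : ℕ) : ℝ) := by positivity
      have hA' := mul_le_mul_of_nonneg_left hA hk
      rw [mul_comm W, mul_assoc (mallowsZ n q) W]
      apply mul_le_mul_of_nonneg_left _ hZ.le
      push_cast at hA' ⊢
      nlinarith

lemma lyB_max (h : GoodSeq P S q) (x y : ℕ) : lyB P S (max x y) ≤ lyB P S x + lyB P S y := by
  have := h.lyB_nonneg x
  have := h.lyB_nonneg y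
  rcases le_total x y with hxy | hxy
  · rw [max_eq_right hxy]; linarith
  · rw [max_eq_left hxy]; linarith

lemma shift (h : GoodSeq P S q) (κ : ℝ)
    (hκ : ∀ n, ∑ a ∈ range (n + 1), q ^ a * lyB P S a ≤ (∑ a ∈ range (n + 1), q ^ a) * κ)
    (s n : ℕ) :
    ∑ a ∈ range (n + 1), q ^ a * lyB P S (a - s)
      ≤ (∑ a ∈ range (n + 1), q ^ a) * (q ^ s * κ) := by
  have hq := h.hq
  have hb : ∀ a, 0 ≤ lyB P S a := h.lyB_nonneg
  have h1 : ∑ a ∈ range (n + 1), q ^ a * lyB P S (a - s)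
      ≤ ∑ a ∈ range (s + (n + 1)), q ^ a * lyB P S (a - s) := by
    apply Finset.sum_le_sum_of_subset_of_nonneg
    · intro a ha
      simp at ha ⊢
      omega
    · intro a _ _
      exact mul_nonneg (by positivity) (hb _)
  refine h1.trans ?_
  rw [Finset.sum_range_add]
  have h2 : ∑ a ∈ range s, q ^ a * lyB P S (a - s) = 0 := by
    apply Finset.sum_eq_zero
    intro a ha
    have : a - s = 0 := by simp at ha; omega
    simp [this, lyB]
  rw [h2, zero_add]
  have h3 := mul_le_mul_of_nonneg_left (hκ n) (pow_pos hq s).le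
  calc _ = q ^ s * ∑ a ∈ range (n + 1), q ^ a * lyB P S a := by
        rw [Finset.mul_sum]
        apply Finset.sum_congr rfl
        intro a _
        rw [pow_add, Nat.add_sub_cancel_left]
        ring
    _ ≤ _ := h3
    _ = _ := by ring

lemma claimB (h : GoodSeq P S q) (κ : ℝ) (hκ0 : 0 ≤ κ)
    (hκ : ∀ n, ∑ a ∈ range (n + 1), q ^ a * lyB P S a ≤ (∑ a ∈ range (n + 1), q ^ a) * κ)
    (s : ℕ) : ∀ n m : ℕ,
    mSum n q (fun π => ((hitG n m s π : ℝ) - s) ^ 2)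
      ≤ mallowsZ n q * (lyB P S (m - s) + κ * ∑ j ∈ range s, q ^ j) := by
  have hq := h.hq
  induction s with
  | zero =>
    intro n m
    have := h.claimA n m 0
    simpa using this
  | succ s ih =>
    intro n m
    rcases n with _ | n
    · rw [mSum_zero q _ (((m - (s + 1) : ℕ) : ℝ) ^ 2) (fun π => ?_), mallowsZ_zero]
      · have h1 := h.lyB_ge (m - (s + 1))
        have h2 : 0 ≤ κ * ∑ j ∈ range (s + 1), q ^ j := by positivity
        linarith
      · rw [hitG_n0]
        congr 1
        rcases le_total m (s + 1) with hm | hm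
        · rw [max_eq_right hm, Nat.sub_eq_zero_of_le hm]
          simp
        · rw [max_eq_left hm, Nat.cast_sub hm]
    · rw [mSum_succ]
      have hZ := mallowsZ_pos n q hq
      set K := κ * ∑ j ∈ range s, q ^ j with hK
      have e1 : ∀ a : Fin (n + 1), q ^ (a : ℕ) *
          mSum n q (fun σ => ((hitG (n + 1) m (s + 1) (consPerm a σ) : ℝ) - (s + 1 : ℕ)) ^ 2)
          ≤ q ^ (a : ℕ) * (mallowsZ n q *
            (lyB P S (m - (s + 1)) + lyB P S (a - s) + K)) := by
        intro a
        apply mul_le_mul_of_nonneg_left _ (by positivity)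
        have e := ih n (max (m - 1) a)
        have e' : max (m - 1) (a : ℕ) - s = max (m - (s + 1)) (a - s) := by omega
        rw [e'] at e
        have e'' := h.lyB_max (m - (s + 1)) (a - s)
        refine le_trans (le_of_eq ?_) (e.trans (mul_le_mul_of_nonneg_left ?_ hZ.le))
        · congr 1
          funext σ
          rw [hitG_cons m (s + 1) s a σ (by omega)]
          push_cast
          ring
        · linarith
      refine (Finset.sum_le_sum fun a _ => e1 a).trans ?_
      rw [← Finset.sum_range (fun a : ℕ => q ^ a * (mallowsZ n q *
            (lyB P S (m - (s + 1)) + lyB P S (a - s) + K)))]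
      have e2 : ∑ a ∈ range (n + 1), q ^ a * (mallowsZ n q *
            (lyB P S (m - (s + 1)) + lyB P S (a - s) + K))
          = mallowsZ n q * ((lyB P S (m - (s + 1)) + K) * (∑ a ∈ range (n + 1), q ^ a)
            + ∑ a ∈ range (n + 1), q ^ a * lyB P S (a - s)) := by
        rw [Finset.mul_sum, ← Finset.sum_add_distrib, Finset.mul_sum]
        apply Finset.sum_congr rfl
        intro a _
        ring
      rw [e2, mallowsZ_succ, Finset.sum_range_succ (fun j => q ^ j) s]
      have hs := h.shift κ hκ s n
      set W := ∑ a ∈ range (n + 1), q ^ a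
      rw [mul_comm W, mul_assoc]
      apply mul_le_mul_of_nonneg_left _ hZ.le
      rw [mul_add κ, ← hK]
      linarith

end GoodSeq

/-- The explicit auxiliary sequence. -/
def expSeq (r : ℝ) (i : ℕ) : ℝ := Real.exp (r ^ i / (1 - r) ^ 2)

lemma expSeq_good (r : ℝ) (hr0 : 0 < r) (hr1 : r < 1) :
    ∃ S, ∀ q, 0 < q → q ≤ r → GoodSeq (expSeq r) S q := by
  set C := 1 / (1 - r) ^ 2 with hC
  have h1r : 0 < 1 - r := by linarith
  have hCpos : 0 < C := by positivity
  refine ⟨C * Real.exp C / (1 - r), fun q hq hqr => ⟨hq, ?_, ?_, ?_⟩⟩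
  · intro i
    exact Real.one_le_exp (by positivity)
  · intro i
    set x := r ^ (i + 1) with hx
    have hx0 : 0 < x := by positivity
    have hxr : x ≤ r := by
      rw [hx, pow_succ]
      have : r ^ i ≤ 1 := pow_le_one₀ hr0.le hr1.le
      nlinarith
    have hqx : q ^ (i + 1) ≤ x := pow_le_pow_left₀ hq.le hqr _
    have e1 : expSeq r (i + 2) = expSeq r (i + 1) * Real.exp (-(x / (1 - r))) := by
      unfold expSeq
      rw [← Real.exp_add]
      congr 1
      have : r ^ (i + 2) = x * r := by rw [hx]; ring
      rw [this, ← hx]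
      field_simp
      ring
    have e2 : Real.exp (-(x / (1 - r))) ≤ 1 - x := by
      rw [Real.exp_neg]
      have e3 : 1 + x / (1 - r) ≤ Real.exp (x / (1 - r)) := by
        have := Real.add_one_le_exp (x / (1 - r)); linarith
      have e4 : (Real.exp (x / (1 - r)))⁻¹ ≤ (1 + x / (1 - r))⁻¹ :=
        inv_anti₀ (by positivity) e3
      refine e4.trans ?_
      have e5 : 1 + x / (1 - r) = (1 - r + x) / (1 - r) := by field_simp
      rw [e5, inv_div, div_le_iff₀ (by linarith)]
      nlinarith
    have hP : 0 < expSeq r (i + 1) := Real.exp_pos _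
    rw [e1]
    nlinarith [mul_le_mul_of_nonneg_left e2 hP.le, mul_le_mul_of_nonneg_left hqx hP.le]
  · intro N
    have hb : ∀ i ∈ range N, expSeq r (i + 1) - 1 ≤ C * Real.exp C * r ^ i := by
      intro i _
      set y := r ^ (i + 1) / (1 - r) ^ 2 with hy
      have hri : r ^ (i + 1) ≤ r ^ i := pow_le_pow_of_le_one hr0.le hr1.le (by omega)
      have hri1 : r ^ i ≤ 1 := pow_le_one₀ hr0.le hr1.le
      have hyC : y ≤ C * r ^ i := by
        rw [hy, div_eq_mul_one_div, mul_comm, ← hC]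
        gcongr
      have hyC' : y ≤ C := hyC.trans (by nlinarith)
      have hy0 : 0 ≤ y := by positivity
      have e1 : Real.exp y - 1 ≤ y * Real.exp y := by
        have e2 : 1 - y ≤ Real.exp (-y) := by
          have := Real.add_one_le_exp (-y); linarith
        have e3 : Real.exp (-y) * Real.exp y = 1 := by rw [← Real.exp_add]; simp
        nlinarith [mul_le_mul_of_nonneg_right e2 (Real.exp_pos y).le]
      change Real.exp y - 1 ≤ _
      calc _ ≤ y * Real.exp y := e1
        _ ≤ (C * r ^ i) * Real.exp C := by gcongr
        _ = _ := by ring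
    refine (Finset.sum_le_sum hb).trans ?_
    rw [← Finset.mul_sum, div_eq_mul_inv]
    apply mul_le_mul_of_nonneg_left _ (by positivity)
    rw [← tsum_geometric_of_lt_one hr0.le hr1]
    exact (summable_geometric_of_lt_one hr0.le hr1).sum_le_tsum _ (fun i _ => by positivity)

theorem arc_chain_return_time (ε : ℝ) (hε : 0 < ε) :
    ∃ c : ℝ, 0 < c ∧
      ∀ (n : ℕ) (q : ℝ) (s : ℕ), 1 ≤ n → 0 < q → q < 1 - ε → s ≤ n →
        mExp n q (fun π => ((hitZero n s π : ℝ) - (s : ℝ)) ^ 2) ≤ c * q := by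
  rcases le_or_gt 1 ε with h1 | h1
  · exact ⟨1, one_pos, fun n q s _ hq hq' _ => by linarith⟩
  set r := 1 - ε with hr
  have hr0 : 0 < r := by linarith
  have hr1 : r < 1 := by linarith
  obtain ⟨S, hS⟩ := expSeq_good r hr0 hr1
  set P := expSeq r
  have hg := hS r hr0 le_rfl
  set B := lyD P S 0 with hB
  have hB0 : 0 ≤ B := hg.lyD_nonneg 0
  refine ⟨B / r / (1 - r) + 1, by have : 0 < 1 - r := by linarith
                                  positivity, ?_⟩
  intro n q s _ hq hqr hs
  have h := hS q hq hqr.le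
  have h1r : 0 < 1 - r := by linarith
  set κ := q * (B / r) with hκd
  have hκ0 : 0 ≤ κ := by positivity
  have hκ : ∀ n, ∑ a ∈ range (n + 1), q ^ a * lyB P S a
      ≤ (∑ a ∈ range (n + 1), q ^ a) * κ := by
    intro n
    have e1 := geo_max q hq (lyD P S) h.lyD_nonneg 0 n
    simp only [Nat.zero_max, range_zero, sum_empty, zero_add] at e1
    refine e1.trans (mul_le_mul_of_nonneg_left ?_ (by positivity))
    have e2 := hg.tailB 0 n
    have e3 : 0 ≤ lyA P (0 + 1) := le_trans (by positivity) (hg.lyA_ge (0 + 1))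
    have e4 : ∑ i ∈ Ico 0 n, lyD P S i * q ^ (i + 1)
        ≤ (q / r) * ∑ i ∈ Ico 0 n, lyD P S i * r ^ (i + 1) := by
      rw [Finset.mul_sum]
      apply Finset.sum_le_sum
      intro i _
      have e5 : q ^ i ≤ r ^ i := pow_le_pow_left₀ hq.le hqr.le _
      have e6 : q / r * (lyD P S i * r ^ (i + 1)) = lyD P S i * (q * r ^ i) := by
        rw [pow_succ]; field_simp
      rw [e6, pow_succ, mul_comm (q ^ i)]
      exact mul_le_mul_of_nonneg_left (mul_le_mul_of_nonneg_left e5 hq.le) (hg.lyD_nonneg i)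
    have e7 : (q / r) * ∑ i ∈ Ico 0 n, lyD P S i * r ^ (i + 1) ≤ (q / r) * B :=
      mul_le_mul_of_nonneg_left (by linarith) (by positivity)
    calc _ ≤ _ := e4
      _ ≤ _ := e7
      _ = κ := by rw [hκd]; ring
  have hmain := h.claimB κ hκ0 hκ s n 0
  have hZ := mallowsZ_pos n q hq
  have hE : mExp n q (fun π => ((hitZero n s π : ℝ) - (s : ℝ)) ^ 2)
      = mSum n q (fun π => ((hitG n 0 s π : ℝ) - s) ^ 2) / mallowsZ n q := by
    unfold mExp mSum mallowsP
    rw [Finset.sum_div]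
    apply Finset.sum_congr rfl
    intro π _
    simp only [hitZero_eq n s hs]
    ring
  rw [hE, div_le_iff₀ hZ, mul_comm _ (mallowsZ n q)]
  refine hmain.trans (mul_le_mul_of_nonneg_left ?_ hZ.le)
  have hgeo : ∑ j ∈ range s, q ^ j ≤ (1 - r)⁻¹ := by
    have hq1 : q < 1 := by linarith
    have e1 : ∑ j ∈ range s, q ^ j ≤ (1 - q)⁻¹ := by
      rw [← tsum_geometric_of_lt_one hq.le hq1]
      exact (summable_geometric_of_lt_one hq.le hq1).sum_le_tsum _ (fun i _ => by positivity)
    exact e1.trans (inv_anti₀ h1r (by linarith))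
  have e0 : lyB P S (0 - s) = 0 := by simp [lyB]
  rw [e0, zero_add]
  calc κ * ∑ j ∈ range s, q ^ j ≤ κ * (1 - r)⁻¹ := mul_le_mul_of_nonneg_left hgeo hκ0
    _ = (B / r / (1 - r)) * q := by rw [hκd]; ring
    _ ≤ _ := by nlinarith
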